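/- A 3-GDD of type g^u exists if and only if u ≥ 3, 2 | g(u−1), and 6 | g²u(u−1). -/

import Mathlib

open Finset

/-- `IsGDD k L` asserts the existence of a group divisible design with all
blocks of size `k` whose group sizes are listed in `L`: the point set is
`Fin L.sum`, the map `grp` assigns each point its group, group `i` has
exactly `L.get i` points, the block set `B` is a nonempty collection of
`k`-element subsets of the points, every pair of points from distinct groups
lies in exactly one block, and no block contains two distinct points of the
same group. -/
def IsGDD (k : ℕ) (L : List ℕ) : Prop :=
  ∃ (grp : Fin L.sum → Fin L.length) (B : Finset (Finset (Fin L.sum))),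
    B.Nonempty ∧
    (∀ i : Fin L.length, (Finset.univ.filter fun x => grp x = i).card = L.get i) ∧
    (∀ b ∈ B, b.card = k) ∧
    (∀ x y : Fin L.sum, grp x ≠ grp y → ∃! b, b ∈ B ∧ x ∈ b ∧ y ∈ b) ∧
    (∀ x y : Fin L.sum, x ≠ y → grp x = grp y → ∀ b ∈ B, x ∈ b → y ∉ b)

/-- A partial Steiner operation: `op` completes every pair of points from distinct groups
to a triple meeting three distinct groups. -/
structure IsTripleOp {X ι : Type*} (grp : X → ι) (op : X → X → X) : Prop where
  comm : ∀ x y, grp x ≠ grp y → op x y = op y x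
  grp_ne : ∀ x y, grp x ≠ grp y → grp (op x y) ≠ grp x
  cancel : ∀ x y, grp x ≠ grp y → op x (op x y) = y

/-- There is a partial Steiner operation on `g * u` points with all groups of size `g`. -/
def HasTripleOp (g u : ℕ) : Prop :=
  ∃ (X ι : Type) (_ : Finite X) (grp : X → ι) (op : X → X → X),
    Nat.card X = g * u ∧ (∀ x, Nat.card {y // grp y = grp x} = g) ∧ IsTripleOp grp op

theorem HasTripleOp.mul {g u : ℕ} (h : HasTripleOp g u) (m : ℕ) [NeZero m] :
    HasTripleOp (g * m) u := by
  obtain ⟨X, ι, _, grp, op, hX, hg, hop⟩ := h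
  refine ⟨X × ZMod m, ι, inferInstance, fun p => grp p.1,
    fun p q => (op p.1 q.1, -p.2 - q.2), ?_, ?_, ?_, ?_, ?_⟩
  · rw [Nat.card_prod, hX, Nat.card_zmod]; ring
  · rintro ⟨x, a⟩
    have e : {y : X × ZMod m // grp y.1 = grp x} ≃ {y // grp y = grp x} × ZMod m :=
      { toFun := fun p => (⟨p.1.1, p.2⟩, p.1.2)
        invFun := fun p => ⟨(p.1.1, p.2), p.1.2⟩
        left_inv := fun _ => rfl
        right_inv := fun _ => rfl }
    rw [Nat.card_congr e, Nat.card_prod, hg, Nat.card_zmod]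
  · rintro ⟨x, a⟩ ⟨y, b⟩ h
    exact Prod.ext (hop.comm x y h) (by ring)
  · rintro ⟨x, a⟩ ⟨y, b⟩ h
    exact hop.grp_ne x y h
  · rintro ⟨x, a⟩ ⟨y, b⟩ h
    exact Prod.ext (hop.cancel x y h) (by ring)

/-- Completion of pairs in the Bose construction over `Q × ZMod 3`, where `mul` is a commutative
quasigroup operation on `Q` and `y = div x z` solves `mul x y = z`. -/
def boseOp {Q : Type*} (mul div : Q → Q → Q) (p q : Q × ZMod 3) : Q × ZMod 3 :=
  if p.2 = q.2 then (mul p.1 q.1, p.2 + 1)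
  else if q.2 = p.2 + 1 then (div p.1 q.1, p.2)
  else (div q.1 p.1, q.2)

theorem zmod_three_cases : ∀ i j : ZMod 3, j = i ∨ j = i + 1 ∨ i = j + 1 := by decide

theorem zmod_three_ne_add_one_add_one : ∀ i : ZMod 3, i ≠ i + 1 + 1 := by decide

theorem isTripleOp_boseOp (k : ℕ) :
    IsTripleOp (Prod.fst : ZMod (2 * k + 1) × ZMod 3 → ZMod (2 * k + 1))
      (boseOp (fun x y => (k + 1) * (x + y)) fun x z => 2 * z - x) := by
  have hk : (2 * k + 1 : ZMod (2 * k + 1)) = 0 := by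
    exact_mod_cast ZMod.natCast_self (2 * k + 1)
  have hne : ∀ x y : ZMod (2 * k + 1), 2 * y - x = x → x = y := fun x y h => by
    linear_combination (k : ZMod (2 * k + 1)) * h + (x - y) * hk
  refine ⟨?_, ?_, ?_⟩ <;>
  · rintro ⟨x, i⟩ ⟨y, j⟩ h
    dsimp only at h
    obtain rfl | rfl | rfl := zmod_three_cases i j <;>
      simp [boseOp, zmod_three_ne_add_one_add_one] <;> grind

theorem HasTripleOp.three (k : ℕ) : HasTripleOp 3 (2 * k + 1) := by
  refine ⟨ZMod (2 * k + 1) × ZMod 3, _, inferInstance, _, _, ?_, ?_, isTripleOp_boseOp k⟩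
  · rw [Nat.card_prod, Nat.card_zmod, Nat.card_zmod, mul_comm]
  · rintro ⟨x, a⟩
    have e : {y : ZMod (2 * k + 1) × ZMod 3 // y.1 = x} ≃ ZMod 3 :=
      { toFun := fun p => p.1.2
        invFun := fun i => ⟨(x, i), rfl⟩
        left_inv := by rintro ⟨⟨y, i⟩, rfl⟩; rfl
        right_inv := fun _ => rfl }
    rw [Nat.card_congr e, Nat.card_zmod]

theorem hasTripleOp_one {X : Type} [Finite X] {op : X → X → X} (h : IsTripleOp id op) :
    HasTripleOp 1 (Nat.card X) :=
  ⟨X, X, inferInstance, id, op, by simp, fun x => by simp, h⟩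

theorem HasTripleOp.bose (k : ℕ) : HasTripleOp 1 (6 * k + 3) := by
  classical
  obtain ⟨hcomm, hne, hcancel⟩ := isTripleOp_boseOp k
  set op := boseOp (fun x y : ZMod (2 * k + 1) => (k + 1) * (x + y)) fun x z => 2 * z - x
  have h : IsTripleOp id fun p q : ZMod (2 * k + 1) × ZMod 3 =>
      if p.1 = q.1 then (p.1, -p.2 - q.2) else op p q := by
    refine ⟨fun p q h => ?_, fun p q h => ?_, fun p q h => ?_⟩
    · by_cases hpq : p.1 = q.1
      · simp [hpq]; ring
      · simp [hpq, Ne.symm hpq, hcomm p q hpq]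
    · by_cases hpq : p.1 = q.1
      · have : ∀ i j : ZMod 3, -i - j = i → i = j := by decide
        simp only [hpq, if_true, id]
        intro h'
        exact h (Prod.ext hpq (this _ _ (congrArg Prod.snd h')))
      · simp only [hpq, if_false, id]
        exact fun h' => hne p q hpq (congrArg Prod.fst h')
    · by_cases hpq : p.1 = q.1
      · simp [hpq]
      · simp [hpq, Ne.symm (hne p q hpq), hcancel p q hpq]
  have := hasTripleOp_one h
  rwa [Nat.card_prod, Nat.card_zmod, Nat.card_zmod,
    show (2 * k + 1) * 3 = 6 * k + 3 by ring] at this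

/-- Completion of pairs in the Skolem construction, for a commutative quasigroup on `Q` in which
`x` is idempotent when `H x` holds and squares to `ν x` otherwise. -/
def skolemOp {Q : Type*} [DecidableEq Q] (mul div : Q → Q → Q) (H : Q → Prop) [DecidablePred H]
    (ν : Q → Q) : Option (Q × ZMod 3) → Option (Q × ZMod 3) → Option (Q × ZMod 3)
  | none, none => none
  | none, some p => some (ν p.1, if H p.1 then p.2 - 1 else p.2 + 1)
  | some p, none => some (ν p.1, if H p.1 then p.2 - 1 else p.2 + 1)
  | some p, some q =>
    let cross (x z : Q) (i : ZMod 3) : Option (Q × ZMod 3) :=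
      if z = mul x x then if H x then some (x, i - 1) else none else some (div x z, i)
    if p.2 = q.2 then some (mul p.1 q.1, p.2 + 1)
    else if q.2 = p.2 + 1 then cross p.1 q.1 p.2
    else cross q.1 p.1 q.2

theorem isTripleOp_skolemOp {Q : Type*} [DecidableEq Q] {mul div : Q → Q → Q} {H : Q → Prop}
    [DecidablePred H] {ν : Q → Q} (hcomm : ∀ x y, mul x y = mul y x)
    (hdiv : ∀ x y, div x (mul x y) = y) (hmul : ∀ x z, mul x (div x z) = z)
    (hνH : ∀ x, H (ν x) ↔ ¬ H x) (hν : ∀ x, ν (ν x) = x)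
    (hsq : ∀ x, mul x x = if H x then x else ν x) :
    IsTripleOp id (skolemOp mul div H ν) := by
  have h1 : ∀ i : ZMod 3, i + 1 + 1 = i - 1 := by decide
  have h2 : ∀ i : ZMod 3, i - 1 ≠ i + 1 := by decide
  have h3 : ∀ i : ZMod 3, i - 1 - 1 = i + 1 := by decide
  have h4 : ∀ i : ZMod 3, i + 1 ≠ i := by decide
  have h5 : ∀ i : ZMod 3, i - 1 ≠ i := by decide
  have h6 : ∀ i : ZMod 3, i - 1 + 1 = i := by decide
  have h7 : ∀ i : ZMod 3, i + 1 - 1 = i := by decide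
  refine ⟨?_, ?_, ?_⟩
  all_goals
    rintro (_ | ⟨x, i⟩) (_ | ⟨y, j⟩) h
    · simp at h
    · grind [skolemOp]
    · grind [skolemOp]
    · simp at h
      obtain rfl | rfl | rfl := zmod_three_cases i j
      · grind [skolemOp]
      · grind [skolemOp]
      · grind [skolemOp]

theorem HasTripleOp.skolem (n : ℕ) : HasTripleOp 1 (6 * n + 1) := by
  let half (s : ℕ) : ℕ := if s % 2 = 0 then s / 2 else s / 2 + n
  let double (z : ℕ) : ℕ := if z < n then 2 * z else 2 * z + 1 - 2 * n
  let mul (x y : Fin (2 * n)) : Fin (2 * n) :=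
    ⟨half (if x.1 + y.1 < 2 * n then x.1 + y.1 else x.1 + y.1 - 2 * n), by grind⟩
  let div (x z : Fin (2 * n)) : Fin (2 * n) :=
    ⟨if x.1 ≤ double z.1 then double z.1 - x.1 else double z.1 + 2 * n - x.1, by grind⟩
  let ν (x : Fin (2 * n)) : Fin (2 * n) := ⟨if x.1 < n then x.1 + n else x.1 - n, by grind⟩
  have h : IsTripleOp id (skolemOp mul div (fun x => x.1 < n) ν) := by
    refine isTripleOp_skolemOp (fun x y => ?_) (fun x y => ?_) (fun x z => ?_) (fun x => ?_)
      (fun x => ?_) (fun x => ?_)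
    · simp only [mul, add_comm]
    · apply Fin.ext
      simp only [mul, div, half, double]
      grind
    · apply Fin.ext
      simp only [mul, div, half, double]
      grind
    · grind
    · grind
    · grind
  have := hasTripleOp_one h
  rwa [Finite.card_option, Nat.card_prod, Nat.card_zmod, Nat.card_fin,
    show 2 * n * 3 + 1 = 6 * n + 1 by ring] at this

/-- The pair completed by a fixed point `p` to a triple, as a label for the groups that arise when
`p` is deleted. -/
def deletedGroup {X : Type*} [DecidableEq X] (op : X → X → X) (p x : X) : Finset X :=
  {x, op p x}

theorem deletedGroup_eq_iff {X : Type*} [DecidableEq X] {op : X → X → X} {p : X}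
    (hp : ∀ x, x ≠ p → op p (op p x) = x) {x y : X} (hx : x ≠ p) (hy : y ≠ p) :
    deletedGroup op p y = deletedGroup op p x ↔ y = x ∨ y = op p x := by
  constructor
  · intro h
    have : y ∈ deletedGroup op p x := h ▸ mem_insert_self _ _
    simpa [deletedGroup] using this
  · rintro (rfl | rfl)
    · rfl
    · rw [deletedGroup, deletedGroup, hp x hx, pair_comm]

theorem card_deletedGroup {X : Type*} [DecidableEq X] {op : X → X → X} {p : X}
    (hp : ∀ x, x ≠ p → op p (op p x) = x) (hpx : ∀ x, x ≠ p → op p x ≠ x)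
    (hpp : ∀ x, x ≠ p → op p x ≠ p) (x : {x // x ≠ p}) :
    Nat.card {y : {x // x ≠ p} // deletedGroup op p y = deletedGroup op p x} = 2 := by
  have e : {y : {x // x ≠ p} | deletedGroup op p y = deletedGroup op p x} =
      {x, ⟨op p x, hpp x x.2⟩} := by
    ext y
    simp [deletedGroup_eq_iff hp x.2 y.2, Subtype.ext_iff]
  have := Set.ncard_pair (a := x) (b := ⟨op p x, hpp x x.2⟩)
    fun h => hpx x x.2 (congrArg Subtype.val h).symm
  rw [← e] at this
  exact this

theorem card_ne_eq {X : Type*} [Finite X] (p : X) {n : ℕ} (h : Nat.card X = n + 1) :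
    Nat.card {x // x ≠ p} = n := by
  classical
  have := Fintype.ofFinite X
  rw [Nat.card_eq_fintype_card] at h ⊢
  rw [Fintype.card_subtype_compl, Fintype.card_subtype_eq, h, Nat.add_sub_cancel]

theorem HasTripleOp.two {u : ℕ} (h : HasTripleOp 1 (2 * u + 1)) : HasTripleOp 2 u := by
  classical
  obtain ⟨X, ι, _, grp, op, hX, hg, hop⟩ := h
  rw [one_mul] at hX
  have hgrp : ∀ x y, x ≠ y → grp x ≠ grp y := fun x y hxy h => by
    have := Finite.card_le_one_iff_subsingleton.1 (hg y).le
    exact hxy (congrArg Subtype.val (this.elim ⟨x, h⟩ ⟨y, rfl⟩))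
  have hcomm : ∀ x y, x ≠ y → op x y = op y x := fun x y h => hop.comm x y (hgrp x y h)
  have hne : ∀ x y, x ≠ y → op x y ≠ x := fun x y h h' =>
    hop.grp_ne x y (hgrp x y h) (congrArg grp h')
  have hcancel : ∀ x y, x ≠ y → op x (op x y) = y := fun x y h => hop.cancel x y (hgrp x y h)
  obtain ⟨p⟩ : Nonempty X := (Nat.card_pos_iff.1 (by rw [hX]; omega)).1
  have hp : ∀ x, x ≠ p → op p (op p x) = x := fun x h => hcancel p x h.symm
  have hpx : ∀ x, x ≠ p → op p x ≠ x := fun x h => by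
    rw [hcomm p x h.symm]; exact hne x p h
  have hpp : ∀ x, x ≠ p → op p x ≠ p := fun x h => hne p x h.symm
  refine ⟨{x // x ≠ p}, _, inferInstance, fun x => deletedGroup op p x,
    fun x y => if h : op x y ≠ p then ⟨op x y, h⟩ else x, ?_,
    card_deletedGroup hp hpx hpp, ?_⟩
  · exact card_ne_eq p hX
  · have key : ∀ x y : {x // x ≠ p}, deletedGroup op p x ≠ deletedGroup op p y →
        x.1 ≠ y.1 ∧ op x y ≠ p := fun x y h => by
      rw [ne_eq, deletedGroup_eq_iff hp y.2 x.2] at h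
      grind
    refine ⟨fun x y h => ?_, fun x y h => ?_, fun x y h => ?_⟩
    · obtain ⟨h1, h2⟩ := key x y h
      grind
    · obtain ⟨h1, h2⟩ := key x y h
      simp only [h2, ne_eq, not_false_eq_true, dite_true]
      rw [deletedGroup_eq_iff hp x.2 h2]
      grind
    · obtain ⟨h1, h2⟩ := key x y h
      have := hcancel x y h1
      have := y.2
      grind

/-- Weight three given to the points other than `p` of a pairwise balanced design whose blocks are
triples, completed by `op`, and one further block `Set.range φ`. -/
theorem hasTripleOp_six {X Y : Type} [Finite X] {u : ℕ} (hX : Nat.card X = 2 * u + 1)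
    {op : X → X → X} {φ : Y → X} {ψ : X → Y} (hψ : ∀ i, ψ (φ i) = i)
    {b : Y × ZMod 3 → Y × ZMod 3 → Y × ZMod 3} (hb : IsTripleOp Prod.fst b) {p : X}
    (hpφ : p ∉ Set.range φ)
    (hcomm : ∀ x y, x ≠ y → ¬ (x ∈ Set.range φ ∧ y ∈ Set.range φ) → op x y = op y x)
    (hne : ∀ x y, x ≠ y → ¬ (x ∈ Set.range φ ∧ y ∈ Set.range φ) → op x y ≠ x)
    (hoff : ∀ x y, x ≠ y → ¬ (x ∈ Set.range φ ∧ y ∈ Set.range φ) →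
      ¬ (x ∈ Set.range φ ∧ op x y ∈ Set.range φ))
    (hcancel : ∀ x y, x ≠ y → ¬ (x ∈ Set.range φ ∧ y ∈ Set.range φ) → op x (op x y) = y) :
    HasTripleOp 6 u := by
  classical
  have hφp : ∀ i, φ i ≠ p := fun i h => hpφ ⟨i, h⟩
  have hφψ : ∀ x, x ∈ Set.range φ → φ (ψ x) = x := by rintro _ ⟨i, rfl⟩; rw [hψ]
  have hφ : ∀ i j, φ i = φ j → i = j := fun i j h => by rw [← hψ i, h, hψ]
  have hp : ∀ x, x ≠ p → op p (op p x) = x := fun x h => by grind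
  have hpx : ∀ x, x ≠ p → op p x ≠ x := fun x h => by grind
  have hpp : ∀ x, x ≠ p → op p x ≠ p := fun x h => by grind
  refine ⟨{x // x ≠ p} × ZMod 3, _, inferInstance, fun x => deletedGroup op p x.1,
    fun x y => if x.1.1 ∈ Set.range φ ∧ y.1.1 ∈ Set.range φ then
        (⟨φ (b (ψ x.1, x.2) (ψ y.1, y.2)).1, hφp _⟩, (b (ψ x.1, x.2) (ψ y.1, y.2)).2)
      else (if h : op x.1 y.1 ≠ p then ⟨op x.1 y.1, h⟩ else x.1, -x.2 - y.2), ?_, ?_, ?_⟩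
  · rw [Nat.card_prod, card_ne_eq p hX, Nat.card_zmod]; ring
  · rintro ⟨x, a⟩
    have e : {y : {x // x ≠ p} × ZMod 3 // deletedGroup op p y.1 = deletedGroup op p x} ≃
        {y : {x // x ≠ p} // deletedGroup op p y = deletedGroup op p x} × ZMod 3 :=
      { toFun := fun q => (⟨q.1.1, q.2⟩, q.1.2)
        invFun := fun q => ⟨(q.1.1, q.2), q.1.2⟩
        left_inv := fun _ => rfl
        right_inv := fun _ => rfl }
    rw [Nat.card_congr e, Nat.card_prod, card_deletedGroup hp hpx hpp, Nat.card_zmod]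
  · have key : ∀ x y : {x // x ≠ p}, deletedGroup op p x ≠ deletedGroup op p y →
        x.1 ≠ y.1 ∧ x.1 ≠ op p y.1 := fun x y h => by
      rw [ne_eq, deletedGroup_eq_iff hp y.2 x.2] at h
      grind
    have key' : ∀ x y : {x // x ≠ p}, deletedGroup op p x ≠ deletedGroup op p y →
        ¬ (x.1 ∈ Set.range φ ∧ y.1 ∈ Set.range φ) → op x y ≠ p := fun x y h h' => by
      obtain ⟨h1, h2⟩ := key x y h
      have := y.2
      grind
    have hψne : ∀ x y : {x // x ≠ p}, deletedGroup op p x ≠ deletedGroup op p y →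
        x.1 ∈ Set.range φ → y.1 ∈ Set.range φ → ψ x ≠ ψ y := fun x y h hx hy h' =>
      (key x y h).1 (by rw [← hφψ x hx, h', hφψ y hy])
    refine ⟨?_, ?_, ?_⟩ <;> rintro ⟨x, a⟩ ⟨y, c⟩ h <;> dsimp only at h <;>
      obtain ⟨h1, h2⟩ := key x y h <;>
      by_cases hxy : x.1 ∈ Set.range φ ∧ y.1 ∈ Set.range φ
    · have := hb.comm (ψ x, a) (ψ y, c) (hψne x y h hxy.1 hxy.2)
      simp only [hxy, and_self, if_true, this]
    · have hxy' : ¬ (y.1 ∈ Set.range φ ∧ x.1 ∈ Set.range φ) := fun h => hxy h.symm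
      have := key' x y h hxy
      simp only [hxy, hxy', if_false, hcomm y x h1.symm hxy']
      simp only [ne_eq, not_false_eq_true, dite_true, this]
      rw [sub_eq_add_neg, sub_eq_add_neg, add_comm]
    · have := hb.grp_ne (ψ x, a) (ψ y, c) (hψne x y h hxy.1 hxy.2)
      simp only [hxy, and_self, if_true]
      rw [ne_eq, deletedGroup_eq_iff hp x.2 (hφp _)]
      rintro (h' | h')
      · exact this (by rw [← hψ (b _ _).1, h'])
      · refine hoff x p x.2 (fun h => hpφ h.2) ⟨hxy.1, ?_⟩
        rw [hcomm x p x.2 (fun h => hpφ h.2), ← h']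
        exact ⟨_, rfl⟩
    · have h3 := key' x y h hxy
      simp only [hxy, if_false, h3, ne_eq, not_false_eq_true, dite_true]
      rw [deletedGroup_eq_iff hp x.2 h3]
      grind
    · have := hb.cancel (ψ x, a) (ψ y, c) (hψne x y h hxy.1 hxy.2)
      simp only [hxy, and_self, if_true, hψ, Set.mem_range_self, Prod.mk.eta, this]
      exact Prod.ext (Subtype.ext (hφψ y hxy.2)) rfl
    · have h3 := key' x y h hxy
      have h4 := hoff x y h1 hxy
      have h5 := hcancel x y h1 hxy
      simp only [hxy, if_false, h3, ne_eq, not_false_eq_true, dite_true, h4, h5, y.2]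
      exact Prod.ext rfl (by ring)

/-- Completion of pairs in a pairwise balanced design on `2 + 3 |R|` points whose blocks are triples
and the block `{∞₀, ∞₁} ∪ {0} × ZMod 3`. -/
def pentaOp {R : Type*} [Ring R] [DecidableEq R] (l : R) (s : R → Bool) :
    Bool ⊕ R × ZMod 3 → Bool ⊕ R × ZMod 3 → Bool ⊕ R × ZMod 3
  | .inl e, .inl _ => .inl e
  | .inl e, .inr p => .inr (-p.1, if s p.1 = e then p.2 + 1 else p.2 - 1)
  | .inr p, .inl e => .inr (-p.1, if s p.1 = e then p.2 + 1 else p.2 - 1)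
  | .inr p, .inr q =>
    let cross (x z : R) (i : ZMod 3) : Bool ⊕ R × ZMod 3 :=
      if z = -x then .inl (s x) else .inr (-2 * z - x, i)
    if p.2 = q.2 then .inr (l * (p.1 + q.1), p.2 + 1)
    else if q.2 = p.2 + 1 then cross p.1 q.1 p.2
    else cross q.1 p.1 q.2

/-- The points of the block of size five. -/
def pentaBlock {R : Type*} [Zero R] : Bool ⊕ ZMod 3 → Bool ⊕ R × ZMod 3 :=
  Sum.map id fun i => (0, i)

theorem inl_mem_range_pentaBlock {R : Type*} [Zero R] (e : Bool) :
    .inl e ∈ Set.range (pentaBlock (R := R)) := ⟨.inl e, rfl⟩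

theorem inr_mem_range_pentaBlock {R : Type*} [Zero R] (x : R) (i : ZMod 3) :
    .inr (x, i) ∈ Set.range (pentaBlock (R := R)) ↔ x = 0 := by
  constructor
  · rintro ⟨e | j, h⟩
    · simp [pentaBlock] at h
    · simp [pentaBlock] at h
      exact h.1.symm
  · rintro rfl
    exact ⟨.inr i, rfl⟩

theorem pentaOp_spec {R : Type*} [CommRing R] [DecidableEq R] {l : R} {s : R → Bool}
    (hl : 2 * l = -1) (hs : ∀ x, x ≠ 0 → s (-x) = !s x) (x y : Bool ⊕ R × ZMod 3) (hxy : x ≠ y)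
    (hmem : ¬ (x ∈ Set.range pentaBlock ∧ y ∈ Set.range pentaBlock)) :
    pentaOp l s x y = pentaOp l s y x ∧ pentaOp l s x y ≠ x ∧
      ¬ (x ∈ Set.range pentaBlock ∧ pentaOp l s x y ∈ Set.range pentaBlock) ∧
      pentaOp l s x (pentaOp l s x y) = y := by
  have h1 : ∀ i : ZMod 3, i + 1 + 1 = i - 1 := by decide
  have h2 : ∀ i : ZMod 3, i - 1 ≠ i + 1 := by decide
  have h3 : ∀ i : ZMod 3, i - 1 - 1 = i + 1 := by decide
  have h4 : ∀ i : ZMod 3, i + 1 ≠ i := by decide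
  have h5 : ∀ i : ZMod 3, i - 1 ≠ i := by decide
  have h6 : ∀ i : ZMod 3, i - 1 + 1 = i := by decide
  have h7 : ∀ i : ZMod 3, i + 1 - 1 = i := by decide
  rcases x with e | ⟨x, i⟩ <;> rcases y with f | ⟨y, j⟩
  · exact absurd ⟨inl_mem_range_pentaBlock e, inl_mem_range_pentaBlock f⟩ hmem
  all_goals
    simp only [inl_mem_range_pentaBlock, inr_mem_range_pentaBlock, true_and, and_true] at hmem
  · have hsy : s (-y) = e ↔ s y ≠ e := by rw [hs y hmem]; cases s y <;> cases e <;> decide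
    clear hs
    refine ⟨?_, ?_, ?_, ?_⟩ <;>
      grind [pentaOp, neg_neg, inr_mem_range_pentaBlock]
  · have hsx : s (-x) = f ↔ s x ≠ f := by rw [hs x hmem]; cases s x <;> cases f <;> decide
    clear hs
    refine ⟨?_, ?_, ?_, ?_⟩ <;>
      grind [pentaOp, neg_neg, inl_mem_range_pentaBlock, inr_mem_range_pentaBlock]
  · have hsx : y = -x → s y = !s x := by rintro rfl; exact hs x fun h => hmem ⟨h, by simp [h]⟩
    have hsy : x = -y → s x = !s y := by rintro rfl; exact hs y fun h => hmem ⟨by simp [h], h⟩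
    clear hs
    have hmid : l * (x + y) = -x → x = y := fun h => by
      linear_combination 2 * h - (x + y) * hl
    have hmid₀ : x = 0 → l * (x + y) = 0 → y = 0 := fun hx h => by
      linear_combination (x + y) * hl - 2 * h - hx
    have hcross : -2 * y - x = x → y = -x := fun h => by
      linear_combination l * h + (x + y) * hl
    have hcross₀ : x = 0 → -2 * y - x = 0 → y = 0 := fun hx h => by
      linear_combination l * h + y * hl + l * hx
    have hinv : -2 * (l * (x + y)) - x = y := by linear_combination -(x + y) * hl
    have hinv' : l * (x + (-2 * y - x)) = y := by linear_combination -y * hl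
    have hinv'' : -2 * x - (-2 * x - y) = y := by ring
    clear hl
    obtain rfl | rfl | rfl := zmod_three_cases i j <;> refine ⟨?_, ?_, ?_, ?_⟩ <;>
      simp [pentaOp, inr_mem_range_pentaBlock, h4, h1, (h5 _).symm, -Set.mem_range,
        -neg_mul] at hmem hxy ⊢ <;>
      grind [pentaOp, -Set.mem_range, inl_mem_range_pentaBlock, inr_mem_range_pentaBlock]

theorem HasTripleOp.six (t : ℕ) : HasTripleOp 6 (6 * t + 8) := by
  set k := 2 * t + 2 with hk
  have : NeZero (2 * k + 1) := ⟨by omega⟩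
  have hk0 : (2 * k + 1 : ZMod (2 * k + 1)) = 0 := by
    exact_mod_cast ZMod.natCast_self (2 * k + 1)
  let s (x : ZMod (2 * k + 1)) : Bool := decide (x.val ≤ k)
  have hs : ∀ x, x ≠ 0 → s (-x) = !s x := fun x hx => by
    have : NeZero x := ⟨hx⟩
    have h1 := ZMod.val_lt x
    have h2 := ZMod.val_neg_of_ne_zero x
    grind
  have h := pentaOp_spec (l := (k : ZMod (2 * k + 1))) (by linear_combination hk0) hs
  have e : ZMod (2 * 2 + 1) ≃ Bool ⊕ ZMod 3 :=
    Fintype.equivOfCardEq (by simp [ZMod.card])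
  have hrange : Set.range (pentaBlock (R := ZMod (2 * k + 1)) ∘ e) = Set.range pentaBlock :=
    e.surjective.range_comp _
  rw [← hrange] at h
  have hinj : Function.Injective (pentaBlock (R := ZMod (2 * k + 1)) ∘ e) :=
    (Sum.map_injective.2 ⟨Function.injective_id, fun i j h => congrArg Prod.snd h⟩).comp
      e.injective
  refine hasTripleOp_six (X := Bool ⊕ ZMod (2 * k + 1) × ZMod 3) ?_
    (Function.leftInverse_invFun hinj) (isTripleOp_boseOp 2) (p := .inr (1, 0)) ?_
    (fun x y h1 h2 => (h x y h1 h2).1) (fun x y h1 h2 => (h x y h1 h2).2.1)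
    (fun x y h1 h2 => (h x y h1 h2).2.2.1) (fun x y h1 h2 => (h x y h1 h2).2.2.2)
  · rw [Nat.card_sum, Nat.card_prod, Nat.card_zmod, Nat.card_zmod, Nat.card_eq_fintype_card,
      Fintype.card_bool]
    omega
  · have : Fact (1 < 2 * k + 1) := ⟨by omega⟩
    rw [hrange, inr_mem_range_pentaBlock]
    exact one_ne_zero

theorem IsTripleOp.isGDD {L : List ℕ} {grp : Fin L.sum → Fin L.length}
    {op : Fin L.sum → Fin L.sum → Fin L.sum} (h : IsTripleOp grp op)
    (hcard : ∀ i, (univ.filter fun x => grp x = i).card = L.get i)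
    (hne : ∃ x y, grp x ≠ grp y) : IsGDD 3 L := by
  classical
  obtain ⟨hcomm, hgrp, hcancel⟩ := h
  have triple : ∀ x y, grp x ≠ grp y → grp (op x y) ≠ grp x ∧ grp (op x y) ≠ grp y ∧
      op y x = op x y ∧ op x (op x y) = y ∧ op (op x y) x = y ∧ op y (op x y) = x ∧
      op (op x y) y = x := fun x y h => by
    have h1 := hcomm x y h
    have h2 := hgrp x y h
    have h3 : grp (op x y) ≠ grp y := by rw [h1]; exact hgrp y x h.symm
    have h4 := hcancel x y h
    have h5 : op y (op x y) = x := by rw [h1]; exact hcancel y x h.symm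
    exact ⟨h2, h3, h1.symm, h4, by rw [hcomm _ _ h2, h4], h5, by rw [hcomm _ _ h3, h5]⟩
  refine ⟨grp, univ.filter fun b => ∃ x y, grp x ≠ grp y ∧ b = {x, y, op x y}, ?_, hcard,
    ?_, ?_, ?_⟩
  · obtain ⟨x, y, h⟩ := hne
    exact ⟨{x, y, op x y}, by simpa using ⟨x, y, h, rfl⟩⟩
  · simp only [mem_filter, mem_univ, true_and]
    rintro _ ⟨x, y, h, rfl⟩
    obtain ⟨h1, h2, -⟩ := triple x y h
    exact card_eq_three.2 ⟨x, y, op x y, fun e => h (e ▸ rfl), fun e => h1 (by rw [← e]),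
      fun e => h2 (by rw [← e]), rfl⟩
  · intro p q hpq
    refine ⟨{p, q, op p q}, by simpa using ⟨p, q, hpq, rfl⟩, ?_⟩
    simp only [mem_filter, mem_univ, true_and]
    rintro _ ⟨⟨x, y, h, rfl⟩, hp, hq⟩
    obtain ⟨h1, h2, h3, h4, h5, h6, h7⟩ := triple x y h
    simp only [mem_insert, mem_singleton] at hp hq
    rcases hp with rfl | rfl | rfl <;> rcases hq with rfl | rfl | rfl <;>
      first
      | exact absurd rfl hpq
      | simp only [h3, h4, h5, h6, h7] <;> ext <;> simp only [mem_insert, mem_singleton] <;> tauto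
  · simp only [mem_filter, mem_univ, true_and]
    rintro p q hpq hgpq _ ⟨x, y, h, rfl⟩ hp hq
    obtain ⟨h1, h2, -⟩ := triple x y h
    simp only [mem_insert, mem_singleton] at hp hq
    grind

theorem HasTripleOp.isGDD {g u : ℕ} (h : HasTripleOp g u) (hg : 0 < g) (hu : 2 ≤ u) :
    IsGDD 3 (List.replicate u g) := by
  classical
  obtain ⟨X, ι, _, grp, op, hX, hfiber, h⟩ := h
  have e : X ≃ Fin (List.replicate u g).sum :=
    Finite.equivFinOfCardEq (by rw [hX, List.sum_replicate, smul_eq_mul, mul_comm])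
  have hrange : Nat.card (Set.range grp) = u := by
    have := Fintype.ofFinite (Set.range grp)
    have hc := Nat.card_congr (Equiv.sigmaFiberEquiv (Set.rangeFactorization grp))
    rw [Nat.card_sigma, hX, sum_congr rfl (g := fun _ => g), sum_const, smul_eq_mul,
      mul_comm, card_univ, ← Nat.card_eq_fintype_card] at hc
    · exact Nat.eq_of_mul_eq_mul_left hg hc
    · rintro ⟨_, x, rfl⟩ -
      rw [← hfiber x]
      exact Nat.card_congr (Equiv.subtypeEquivRight fun y => Subtype.ext_iff)
  have f : Set.range grp ≃ Fin (List.replicate u g).length :=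
    Finite.equivFinOfCardEq (by rw [hrange, List.length_replicate])
  let grp' (x : Fin (List.replicate u g).sum) := f ⟨grp (e.symm x), Set.mem_range_self _⟩
  have hgrp' : ∀ x y, grp' x = grp' y ↔ grp (e.symm x) = grp (e.symm y) := fun x y => by
    simp [grp']
  have hsurj : Function.Surjective grp' := fun i => by
    obtain ⟨⟨_, x, rfl⟩, rfl⟩ := f.surjective i
    exact ⟨e x, by simp [grp']⟩
  refine IsTripleOp.isGDD (grp := grp') (op := fun x y => e (op (e.symm x) (e.symm y)))
    ⟨?_, ?_, ?_⟩ ?_ ?_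
  · intro x y hxy
    rw [ne_eq, hgrp'] at hxy
    rw [h.comm _ _ hxy]
  · intro x y hxy
    rw [ne_eq, hgrp'] at hxy ⊢
    rw [Equiv.symm_apply_apply]
    exact h.grp_ne _ _ hxy
  · intro x y hxy
    rw [ne_eq, hgrp'] at hxy
    rw [Equiv.symm_apply_apply, h.cancel _ _ hxy, Equiv.apply_symm_apply]
  · intro i
    obtain ⟨x, rfl⟩ := hsurj i
    rw [List.get_eq_getElem, List.getElem_replicate, ← Fintype.card_subtype,
      ← Nat.card_eq_fintype_card]
    refine Eq.trans ?_ (hfiber (e.symm x))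
    exact Nat.card_congr (e.symm.subtypeEquiv fun y => hgrp' y x)
  · obtain ⟨x, hx⟩ := hsurj ⟨0, by rw [List.length_replicate]; omega⟩
    obtain ⟨y, hy⟩ := hsurj ⟨1, by rw [List.length_replicate]; omega⟩
    exact ⟨x, y, by rw [hx, hy]; simp⟩

theorem IsGDD.necessary {g u : ℕ} (h : IsGDD 3 (List.replicate u g)) :
    3 ≤ u ∧ 2 ∣ g * (u - 1) ∧ 6 ∣ g ^ 2 * u * (u - 1) := by
  classical
  obtain ⟨grp, B, ⟨b₀, hb₀⟩, hgroup, hcard, hpair, hgrp⟩ := h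
  have hg : ∀ i, (univ.filter fun x => grp x = i).card = g := fun i => by
    rw [hgroup, List.get_eq_getElem, List.getElem_replicate]
  have hn : Fintype.card (Fin (List.replicate u g).sum) = u * g := by
    rw [Fintype.card_fin, List.sum_replicate, smul_eq_mul]
  have hinj : ∀ b ∈ B, ∀ x ∈ b, ∀ y ∈ b, grp x = grp y → x = y := fun b hb x hx y hy h => by
    by_contra hxy
    exact hgrp x y hxy h b hb hx hy
  have hother : ∀ x, (univ.filter fun y => grp x ≠ grp y).card = g * (u - 1) := fun x => by
    have := card_filter_add_card_filter_not (s := univ) fun y => grp y = grp x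
    rw [hg, card_univ, hn] at this
    simp only [ne_eq, eq_comm (a := grp x), Nat.mul_sub_one, mul_comm g u]
    omega
  have hu : 3 ≤ u := by
    have := card_le_card_of_injOn (s := b₀) (t := univ) grp (fun _ _ => mem_univ _)
      fun x hx y hy => hinj b₀ hb₀ x hx y hy
    rwa [hcard b₀ hb₀, card_univ, Fintype.card_fin, List.length_replicate] at this
  refine ⟨hu, ?_, ?_⟩
  · have x : Fin (List.replicate u g).sum := (card_pos.1 (by rw [hcard b₀ hb₀]; simp)).choose
    have : (univ.filter fun y => grp x ≠ grp y) =
        (B.filter fun b => x ∈ b).biUnion fun b => b.erase x := by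
      ext y
      simp only [mem_filter, mem_univ, true_and, mem_biUnion, mem_erase]
      constructor
      · intro hxy
        obtain ⟨b, ⟨hb, hx, hy⟩, -⟩ := hpair x y hxy
        exact ⟨b, ⟨hb, hx⟩, fun e => hxy (e ▸ rfl), hy⟩
      · rintro ⟨b, ⟨hb, hx⟩, hyx, hy⟩ hxy
        exact hyx (hinj b hb y hy x hx hxy.symm)
    rw [← hother x, this, card_biUnion]
    · refine dvd_sum fun b hb => ?_
      rw [mem_filter] at hb
      rw [card_erase_of_mem hb.2, hcard b hb.1]
    · intro b hb c hc hbc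
      rw [mem_coe, mem_filter] at hb hc
      refine disjoint_left.2 fun y hyb hyc => hbc ?_
      rw [mem_erase] at hyb hyc
      refine (hpair x y fun h => hyb.1 (hinj b hb.1 y hyb.2 x hb.2 h.symm)).unique
        ⟨hb.1, hb.2, hyb.2⟩ ⟨hc.1, hc.2, hyc.2⟩
  · have hpairs : (univ.filter fun p : _ × _ => grp p.1 ≠ grp p.2) =
        B.biUnion fun b => b.offDiag := by
      ext ⟨x, y⟩
      simp only [mem_filter, mem_univ, true_and, mem_biUnion, mem_offDiag]
      constructor
      · intro hxy
        obtain ⟨b, ⟨hb, hx, hy⟩, -⟩ := hpair x y hxy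
        exact ⟨b, hb, hx, hy, fun e => hxy (e ▸ rfl)⟩
      · rintro ⟨b, hb, hx, hy, hxy⟩ h
        exact hxy (hinj b hb x hx y hy h)
    have hcount : (univ.filter fun p : _ × _ => grp p.1 ≠ grp p.2).card =
        g ^ 2 * u * (u - 1) := by
      rw [card_filter, Fintype.sum_prod_type]
      simp only [← card_filter, hother, sum_const, card_univ, hn, smul_eq_mul]
      ring
    rw [← hcount, hpairs, card_biUnion]
    · refine dvd_sum fun b hb => ?_
      rw [offDiag_card, hcard b hb]
    · intro b hb c hc hbc
      refine disjoint_left.2 fun p hpb hpc => hbc ?_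
      rw [mem_offDiag] at hpb hpc
      exact (hpair p.1 p.2 fun h => hpb.2.2 (hinj b hb _ hpb.1 _ hpb.2.1 h)).unique
        ⟨hb, hpb.1, hpb.2.1⟩ ⟨hc, hpc.1, hpc.2.1⟩

theorem HasTripleOp.steiner {v : ℕ} (hv : v % 6 = 1 ∨ v % 6 = 3) : HasTripleOp 1 v := by
  rcases hv with hv | hv
  · have := HasTripleOp.skolem (v / 6)
    rwa [show 6 * (v / 6) + 1 = v by omega] at this
  · have := HasTripleOp.bose (v / 6)
    rwa [show 6 * (v / 6) + 3 = v by omega] at this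

theorem HasTripleOp.of_dvd {g d u : ℕ} (h : HasTripleOp d u) (hg : 0 < g) (hd : d ∣ g) :
    HasTripleOp g u := by
  obtain ⟨m, rfl⟩ := hd
  have : NeZero m := ⟨(pos_of_mul_pos_right hg (Nat.zero_le d)).ne'⟩
  exact h.mul m

theorem HasTripleOp.of_dvd_of_dvd {g u : ℕ} (hg : 0 < g) (hu : 3 ≤ u) (h2 : 2 ∣ g * (u - 1))
    (h6 : 6 ∣ g ^ 2 * u * (u - 1)) : HasTripleOp g u := by
  have hg2 : 2 ∣ g ∨ u % 2 = 1 := (Nat.prime_two.dvd_mul.1 h2).imp_right fun h => by omega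
  have hg3 : 3 ∣ g ∨ u % 3 = 0 ∨ u % 3 = 1 := by
    have h3 : 3 ∣ g ^ 2 * u * (u - 1) := (by norm_num : 3 ∣ 6).trans h6
    rw [Nat.prime_three.dvd_mul, Nat.prime_three.dvd_mul] at h3
    rcases h3 with (h | h) | h
    · exact .inl (Nat.prime_three.dvd_of_dvd_pow h)
    · omega
    · omega
  by_cases hu3 : u % 3 = 2
  · by_cases hu2 : u % 2 = 1
    · have := HasTripleOp.three (u / 2)
      rw [show 2 * (u / 2) + 1 = u by omega] at this
      exact this.of_dvd hg (by omega)
    · have := HasTripleOp.six ((u - 8) / 6)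
      rw [show 6 * ((u - 8) / 6) + 8 = u by omega] at this
      exact this.of_dvd hg (by omega)
  · by_cases hu2 : u % 2 = 1
    · exact (HasTripleOp.steiner (by omega)).of_dvd hg (one_dvd g)
    · exact (HasTripleOp.steiner (by omega)).two.of_dvd hg (by omega)

/-- A 3-GDD of type `g^u` (with `g` positive) exists if and only if
`u ≥ 3`, `2 ∣ g(u−1)`, and `6 ∣ g²u(u−1)`. -/
theorem threeGDD_exists_iff (g u : ℕ) (hg : 0 < g) :
    IsGDD 3 (List.replicate u g) ↔
      3 ≤ u ∧ 2 ∣ g * (u - 1) ∧ 6 ∣ g ^ 2 * u * (u - 1) :=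
  ⟨IsGDD.necessary, fun ⟨hu, h2, h6⟩ =>
    (HasTripleOp.of_dvd_of_dvd hg hu h2 h6).isGDD hg (by omega)⟩
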